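/- (Proposition 4 of the paper: knapsack completion bound, for set-partitioning duals.) Suppose the arc dual-contribution function has the form γ(i,j) = −α_j for all i, where α_0 = 0 and α_1,…,α_N ∈ ℝ are the duals of the partitioning constraints, so that g_i := max_{j ∈ {0,…,N}} (−γ(j,i)) = α_i for each customer i. Assume μ_i > 0 for every customer i, and for C ≥ 0 define the unbounded-knapsack value κ(C) = sup { Σ_{i=1}^N m_i·α_i : m ∈ ℕ^N, Σ_{i=1}^N m_i·μ_i ≤ C } (a finite maximum, with κ(C) ≥ 0 attained at m = 0). Fix a partial route suffix σ = (s_1,…,s_l) of customers with first customer n = s_1, and a real remaining load rl ≥ 0. Then for every finite sequence e = (u_1,…,u_h) of customers with μ_{u_1} + … + μ_{u_h} ≤ rl, the reduced costs of the routes r_e = (v_0, u_1,…,u_h, s_1,…,s_l, v_0) and r_0 = (v_0, s_1,…,s_l, v_0) satisfy φ(r_e) ≥ φ(r_0) − κ(rl). -/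

import Mathlib

/-- `Ψ(k,q) = max(⌈(k−q)/Q⌉, 0)`: number of replenishment trips of capacity `Q`
needed to fulfill a demand of `k` with remaining quantity `q`. -/
noncomputable def psi (Q k q : ℕ) : ℤ :=
  max ⌈((k : ℚ) - (q : ℚ)) / (Q : ℚ)⌉ 0

/-- The value functions `ν^r(i,q)` of a route `r = (v_0, v_{t_1},…,v_{t_h}, v_0)`
(with `t 0 = 0`), computed by backward recursion on the fuel `h − i`:
`nuF Q d p t (h - i) i q = ν^r(i,q)`. -/
noncomputable def nuF (Q : ℕ) (d p : ℕ → ℕ → ℝ) (s : ℕ → ℕ) :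
    ℕ → ℕ → ℕ → ℝ
  | 0, i, _ => d (s i) 0
  | j + 1, i, q =>
      min
        (d (s i) (s (i + 1)) + ∑' k : ℕ,
          ((d (s (i + 1)) 0 + d 0 (s (i + 1))) * (psi Q k q : ℝ)
            + nuF Q d p s j (i + 1)
                ((Q : ℤ) * psi Q k q + (q : ℤ) - (k : ℤ)).toNat) * p (s (i + 1)) k)
        (d (s i) 0 + d 0 (s (i + 1)) + ∑' k : ℕ,
          ((d (s (i + 1)) 0 + d 0 (s (i + 1))) * (psi Q k Q : ℝ)
            + nuF Q d p s j (i + 1)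
                ((Q : ℤ) * psi Q k Q + (Q : ℤ) - (k : ℤ)).toNat) * p (s (i + 1)) k)

/-- The node sequence of the route visiting the customers of the list `t` in
order (node `0` is the depot, node `j ≥ 1` is the `j`-th customer of `t`). -/
def routeSeq (t : List ℕ) : ℕ → ℕ := fun j => if j = 0 then 0 else t.getD (j - 1) 0

/-- Expected cost `c_r = ν^r(0,Q)` of the route visiting the customers of `t`
in order, under optimal restocking. -/
noncomputable def routeCost (Q : ℕ) (d p : ℕ → ℕ → ℝ) (t : List ℕ) : ℝ :=
  nuF Q d p (routeSeq t) t.length 0 Q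

/-- `chainVal c a [w₁,…,w_m] b = c(a,w₁) + c(w₁,w₂) + … + c(w_m,b)`
(equal to `c(a,b)` for the empty list): total arc value of the path
`a → w₁ → … → w_m → b`. -/
def chainVal (c : ℕ → ℕ → ℝ) : ℕ → List ℕ → ℕ → ℝ
  | a, [], b => c a b
  | a, w :: ws, b => c a w + chainVal c w ws b

/-- Reduced cost `φ(r) = c_r + Σ γ` over all consecutive arcs of the route
visiting the customers of `t` in order. -/
noncomputable def routePhi (Q : ℕ) (d p γ : ℕ → ℕ → ℝ) (t : List ℕ) : ℝ :=
  routeCost Q d p t + chainVal γ 0 t 0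

/-- Expected demand `μ_i = Σ_k k·p_i(k)` of customer `i`. -/
noncomputable def muE (p : ℕ → ℕ → ℝ) (i : ℕ) : ℝ := ∑' k : ℕ, (k : ℝ) * p i k

/-- The unbounded-knapsack value
`κ(C) = sup { Σ_{i=1}^N m_i·α_i : m ∈ ℕ^N, Σ_{i=1}^N m_i·μ_i ≤ C }`. -/
noncomputable def kappa (N : ℕ) (μ α : ℕ → ℝ) (C : ℝ) : ℝ :=
  sSup {x : ℝ | ∃ m : ℕ → ℕ,
    (∑ i ∈ Finset.Icc 1 N, (m i : ℝ) * μ i) ≤ C ∧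
    x = ∑ i ∈ Finset.Icc 1 N, (m i : ℝ) * α i}

theorem psi_nonneg (Q k q : ℕ) : 0 ≤ psi Q k q := le_max_right _ _

theorem sub_le_mul_psi {Q : ℕ} (hQ : 1 ≤ Q) (k q : ℕ) : (k : ℤ) - q ≤ Q * psi Q k q := by
  have hQ' : (0 : ℚ) < Q := by exact_mod_cast hQ
  have h1 : ((k : ℚ) - q) / Q ≤ (psi Q k q : ℤ) :=
    (Int.le_ceil _).trans (Int.cast_le.2 (le_max_left _ _))
  rw [div_le_iff₀ hQ'] at h1
  have h2 : (k : ℤ) - q ≤ psi Q k q * Q := by exact_mod_cast h1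
  linarith [mul_comm (psi Q k q) (Q : ℤ)]

theorem mul_psi_sub_one_lt {Q : ℕ} (hQ : 1 ≤ Q) {k q : ℕ} (h : 0 < psi Q k q) :
    (Q : ℤ) * (psi Q k q - 1) < k - q := by
  have hQ' : (0 : ℚ) < Q := by exact_mod_cast hQ
  have he : psi Q k q = ⌈((k : ℚ) - q) / Q⌉ := by
    rcases max_choice ⌈((k : ℚ) - q) / Q⌉ 0 with h' | h'
    · exact h'
    · have : psi Q k q = 0 := h'
      omega
  have h1 : ((psi Q k q : ℤ) : ℚ) - 1 < ((k : ℚ) - q) / Q := by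
    rw [he]
    linarith [Int.ceil_lt_add_one (((k : ℚ) - q) / Q)]
  rw [lt_div_iff₀ hQ'] at h1
  have h2 : (psi Q k q - 1) * (Q : ℤ) < k - q := by exact_mod_cast h1
  linarith [mul_comm (psi Q k q - 1) (Q : ℤ)]

theorem psi_le_self {Q : ℕ} (hQ : 1 ≤ Q) (k q : ℕ) : psi Q k q ≤ k := by
  rcases (psi_nonneg Q k q).eq_or_lt with h | h
  · omega
  · have h1 := mul_psi_sub_one_lt hQ h
    have hQ' : (1 : ℤ) ≤ Q := by exact_mod_cast hQ
    nlinarith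

theorem psi_anti {Q : ℕ} (hQ : 1 ≤ Q) (k : ℕ) {q q' : ℕ} (h : q ≤ q') :
    psi Q k q' ≤ psi Q k q := by
  by_contra! hlt
  have h0 := psi_nonneg Q k q
  have h1 := mul_psi_sub_one_lt hQ (h0.trans_lt hlt)
  have h2 := sub_le_mul_psi hQ k q
  have hQ' : (1 : ℤ) ≤ Q := by exact_mod_cast hQ
  have : (q : ℤ) ≤ q' := by exact_mod_cast h
  nlinarith

theorem psi_le_add_one {Q : ℕ} (hQ : 1 ≤ Q) (k q : ℕ) {q' : ℕ} (h' : q' ≤ Q) :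
    psi Q k q ≤ psi Q k q' + 1 := by
  by_contra! hlt
  have h0 := psi_nonneg Q k q'
  have h1 := mul_psi_sub_one_lt (Q := Q) (k := k) (q := q) hQ (by omega)
  have h2 := sub_le_mul_psi hQ k q'
  have hQ' : (1 : ℤ) ≤ Q := by exact_mod_cast hQ
  have : (q' : ℤ) ≤ Q := by exact_mod_cast h'
  nlinarith

/-- The load left after serving a demand `k` with initial load `q`. -/
noncomputable def loadAfter (Q k q : ℕ) : ℕ := ((Q : ℤ) * psi Q k q + (q : ℤ) - (k : ℤ)).toNat

theorem loadAfter_le {Q : ℕ} (hQ : 1 ≤ Q) (k : ℕ) {q : ℕ} (hq : q ≤ Q) :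
    loadAfter Q k q ≤ Q := by
  unfold loadAfter
  rcases (psi_nonneg Q k q).eq_or_lt with h | h
  · rw [← h]; omega
  · have h1 := mul_psi_sub_one_lt hQ h
    rw [mul_sub] at h1
    omega

/-- Expected cost of serving customer `w` on arrival with load `q`, when continuing with load `x`
costs `f x`. -/
noncomputable def serveCost (Q : ℕ) (d p : ℕ → ℕ → ℝ) (w : ℕ) (f : ℕ → ℝ) (q : ℕ) : ℝ :=
  ∑' k : ℕ, ((d w 0 + d 0 w) * (psi Q k q : ℝ) + f (loadAfter Q k q)) * p w k

/-- Optimal restocking cost-to-go from node `a` with load `q` when the customers of the list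
remain to be visited. -/
noncomputable def costToGo (Q : ℕ) (d p : ℕ → ℕ → ℝ) : ℕ → List ℕ → ℕ → ℝ
  | a, [], _ => d a 0
  | a, w :: t, q =>
      min (d a w + serveCost Q d p w (costToGo Q d p w t) q)
        (d a 0 + d 0 w + serveCost Q d p w (costToGo Q d p w t) Q)

theorem nuF_eq_costToGo (Q : ℕ) (d p : ℕ → ℕ → ℝ) (s : ℕ → ℕ) (t : List ℕ) :
    ∀ i q, (∀ j < t.length, s (i + 1 + j) = t.getD j 0) →
      nuF Q d p s t.length i q = costToGo Q d p (s i) t q := by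
  induction t with
  | nil => intro i q _; rfl
  | cons w t ih =>
    intro i q h
    have hw : s (i + 1) = w := by simpa using h 0 (by simp)
    have hi : ∀ x, nuF Q d p s t.length (i + 1) x = costToGo Q d p w t x := by
      intro x
      rw [← hw]
      refine ih (i + 1) x fun j hj => ?_
      have := h (j + 1) (by simpa using hj)
      rw [List.getD_cons_succ] at this
      rw [← this]
      congr 1
      omega
    simp only [List.length_cons, nuF, costToGo, serveCost, loadAfter, hw, hi]

theorem routeCost_eq_costToGo (Q : ℕ) (d p : ℕ → ℕ → ℝ) (t : List ℕ) :
    routeCost Q d p t = costToGo Q d p 0 t Q := by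
  have h := nuF_eq_costToGo Q d p (routeSeq t) t 0 Q (fun j _ => by
    have h1 : (0 + 1 + j) ≠ 0 := by omega
    have h2 : 0 + 1 + j - 1 = j := by omega
    simp only [routeSeq, if_neg h1, h2])
  simpa [routeCost, routeSeq] using h

theorem serveCost_summable {Q : ℕ} (hQ : 1 ≤ Q) {d p : ℕ → ℕ → ℝ} {w : ℕ}
    (hdw : 0 ≤ d w 0 + d 0 w) (hp0 : ∀ k, 0 ≤ p w k) (hp1 : Summable (p w))
    (hpk : Summable fun k : ℕ => (k : ℝ) * p w k) {f : ℕ → ℝ} {C : ℝ}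
    (hf0 : ∀ x, 0 ≤ f x) (hfC : ∀ x, f x ≤ C) (q : ℕ) :
    Summable fun k : ℕ =>
      ((d w 0 + d 0 w) * (psi Q k q : ℝ) + f (loadAfter Q k q)) * p w k := by
  refine Summable.of_nonneg_of_le (fun k => ?_) (fun k => ?_)
    ((hpk.mul_left (d w 0 + d 0 w)).add (hp1.mul_left C))
  · have h1 : (0 : ℝ) ≤ psi Q k q := by exact_mod_cast psi_nonneg Q k q
    exact mul_nonneg (add_nonneg (mul_nonneg hdw h1) (hf0 _)) (hp0 k)
  · have h1 : (psi Q k q : ℝ) ≤ k := by exact_mod_cast psi_le_self hQ k q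
    rw [← mul_assoc, ← add_mul]
    exact mul_le_mul_of_nonneg_right
      (add_le_add (mul_le_mul_of_nonneg_left h1 hdw) (hfC _)) (hp0 k)

theorem serveCost_anti {Q : ℕ} (hQ : 1 ≤ Q) {d p : ℕ → ℕ → ℝ} {w : ℕ}
    (hdw : 0 ≤ d w 0 + d 0 w) (hp0 : ∀ k, 0 ≤ p w k) (hp1 : Summable (p w))
    (hpk : Summable fun k : ℕ => (k : ℝ) * p w k) {f : ℕ → ℝ} {C : ℝ}
    (hf0 : ∀ x, 0 ≤ f x) (hfC : ∀ x, f x ≤ C)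
    (hanti : ∀ x y, x ≤ y → y ≤ Q → f y ≤ f x)
    (hjump : ∀ x y, x ≤ Q → y ≤ Q → f x ≤ d w 0 + d 0 w + f y)
    {q q' : ℕ} (hqq : q ≤ q') (hq' : q' ≤ Q) :
    serveCost Q d p w f q' ≤ serveCost Q d p w f q := by
  refine Summable.tsum_le_tsum (fun k => mul_le_mul_of_nonneg_right ?_ (hp0 k))
    (serveCost_summable hQ hdw hp0 hp1 hpk hf0 hfC q')
    (serveCost_summable hQ hdw hp0 hp1 hpk hf0 hfC q)
  have h1 := psi_anti hQ k hqq
  have h2 := psi_le_add_one hQ k q hq'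
  have h3 := loadAfter_le hQ k hq'
  have h4 := loadAfter_le hQ k (hqq.trans hq')
  rcases h1.eq_or_lt with h | h
  · rw [h]
    refine add_le_add_right (hanti _ _ ?_ h3) _
    unfold loadAfter
    rw [h]
    omega
  · have he : psi Q k q = psi Q k q' + 1 := by omega
    have hj := hjump _ _ h3 h4
    rw [he]
    push_cast
    linarith

theorem costToGo_nonneg {Q N : ℕ} {d p : ℕ → ℕ → ℝ}
    (hd0 : ∀ i j, i ≤ N → j ≤ N → 0 ≤ d i j) (hp : ∀ m, 1 ≤ m → m ≤ N → ∀ k, 0 ≤ p m k)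
    (t : List ℕ) : (∀ u ∈ t, 1 ≤ u ∧ u ≤ N) → ∀ a ≤ N, ∀ q, 0 ≤ costToGo Q d p a t q := by
  induction t with
  | nil => intro _ a ha q; exact hd0 a 0 ha (Nat.zero_le _)
  | cons w t ih =>
    intro ht a ha q
    obtain ⟨hw1, hwN⟩ := ht w (by simp)
    have ih' := ih (fun u hu => ht u (by simp [hu])) w hwN
    have h0 := hd0 a 0 ha (Nat.zero_le _)
    have h1 := hd0 0 w (Nat.zero_le _) hwN
    have h2 := hd0 w 0 hwN (Nat.zero_le _)
    have h3 := hd0 a w ha hwN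
    have hs : ∀ x, 0 ≤ serveCost Q d p w (costToGo Q d p w t) x := fun x =>
      tsum_nonneg fun k => by
        have : (0 : ℝ) ≤ psi Q k x := by exact_mod_cast psi_nonneg Q k x
        exact mul_nonneg (add_nonneg (mul_nonneg (add_nonneg h2 h1) this) (ih' _)) (hp w hw1 hwN k)
    exact le_min (add_nonneg h3 (hs _)) (add_nonneg (add_nonneg h0 h1) (hs _))

theorem exists_costToGo_le (Q : ℕ) (d p : ℕ → ℕ → ℝ) (a : ℕ) (t : List ℕ) :
    ∃ C, ∀ q, costToGo Q d p a t q ≤ C := by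
  cases t with
  | nil => exact ⟨d a 0, fun _ => le_rfl⟩
  | cons w t => exact ⟨_, fun _ => min_le_right _ _⟩

theorem costToGo_anti_and_jump {Q N : ℕ} (hQ : 1 ≤ Q) {d p : ℕ → ℕ → ℝ}
    (hd0 : ∀ i j, i ≤ N → j ≤ N → 0 ≤ d i j)
    (htri : ∀ i j k, i ≤ N → j ≤ N → k ≤ N → d i j ≤ d i k + d k j)
    (hp : ∀ m, 1 ≤ m → m ≤ N →
      (∀ k, 0 ≤ p m k) ∧ HasSum (p m) 1 ∧ Summable fun k : ℕ => (k : ℝ) * p m k)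
    (t : List ℕ) : (∀ u ∈ t, 1 ≤ u ∧ u ≤ N) → ∀ a ≤ N,
      (∀ x y, x ≤ y → y ≤ Q → costToGo Q d p a t y ≤ costToGo Q d p a t x) ∧
      (∀ b ≤ N, ∀ x y, x ≤ Q → y ≤ Q →
        costToGo Q d p b t x ≤ d b 0 + d 0 a + costToGo Q d p a t y) ∧
      (∀ y ≤ Q, costToGo Q d p 0 t Q ≤ d 0 a + costToGo Q d p a t y) := by
  induction t with
  | nil =>
    intro _ a ha
    have h0 : (0 : ℕ) ≤ N := Nat.zero_le _
    refine ⟨fun _ _ _ _ => le_rfl, fun b hb _ _ _ _ => ?_, fun _ _ => htri 0 0 a h0 h0 ha⟩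
    simp only [costToGo]
    linarith [hd0 a 0 ha h0, hd0 0 a h0 ha]
  | cons w t ih =>
    intro ht a ha
    have h0 : (0 : ℕ) ≤ N := Nat.zero_le _
    obtain ⟨hw1, hwN⟩ := ht w (by simp)
    have ht' : ∀ u ∈ t, 1 ≤ u ∧ u ≤ N := fun u hu => ht u (by simp [hu])
    obtain ⟨hanti, hjump, -⟩ := ih ht' w hwN
    obtain ⟨hp0, hp1, hpk⟩ := hp w hw1 hwN
    obtain ⟨C, hC⟩ := exists_costToGo_le Q d p w t
    have hE : ∀ q q', q ≤ q' → q' ≤ Q →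
        serveCost Q d p w (costToGo Q d p w t) q' ≤ serveCost Q d p w (costToGo Q d p w t) q :=
      fun q q' => serveCost_anti hQ (add_nonneg (hd0 w 0 hwN h0) (hd0 0 w h0 hwN)) hp0
        hp1.summable hpk
        (costToGo_nonneg hd0 (fun m h1 h2 => (hp m h1 h2).1) t ht' w hwN) hC hanti
        (hjump w hwN)
    have h0w := htri 0 w a h0 hwN ha
    have ha0 := hd0 a 0 ha h0
    have h0a := hd0 0 a h0 ha
    refine ⟨fun x y hxy hy => min_le_min_right _ (add_le_add_right (hE x y hxy hy) _),
      fun b hb x y hx hy => ?_, fun y hy => ?_⟩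
    · refine (min_le_right _ _).trans ?_
      have := hE y Q hy le_rfl
      rw [costToGo, ← min_add_add_left]
      exact le_min (by linarith) (by linarith)
    · refine (min_le_left _ _).trans ?_
      have := hE y Q hy le_rfl
      rw [costToGo, ← min_add_add_left]
      exact le_min (by linarith) (by linarith)

theorem costToGo_le_append {Q N : ℕ} (hQ : 1 ≤ Q) {d p : ℕ → ℕ → ℝ}
    (hd0 : ∀ i j, i ≤ N → j ≤ N → 0 ≤ d i j)
    (htri : ∀ i j k, i ≤ N → j ≤ N → k ≤ N → d i j ≤ d i k + d k j)
    (hp : ∀ m, 1 ≤ m → m ≤ N →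
      (∀ k, 0 ≤ p m k) ∧ HasSum (p m) 1 ∧ Summable fun k : ℕ => (k : ℝ) * p m k)
    {σ : List ℕ} (hσ : ∀ u ∈ σ, 1 ≤ u ∧ u ≤ N) (e : List ℕ) :
    (∀ u ∈ e, 1 ≤ u ∧ u ≤ N) → costToGo Q d p 0 σ Q ≤ costToGo Q d p 0 (e ++ σ) Q := by
  induction e with
  | nil => intro _; exact le_rfl
  | cons w e ih =>
    intro he
    have h0 : (0 : ℕ) ≤ N := Nat.zero_le _
    obtain ⟨hw1, hwN⟩ := he w (by simp)
    have he' : ∀ u ∈ e, 1 ≤ u ∧ u ≤ N := fun u hu => he u (by simp [hu])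
    refine (ih he').trans ?_
    have ht : ∀ u ∈ e ++ σ, 1 ≤ u ∧ u ≤ N := fun u hu =>
      (List.mem_append.1 hu).elim (he' u) (hσ u)
    rw [List.cons_append]
    generalize e ++ σ = t at ht
    obtain ⟨-, -, hstart⟩ := costToGo_anti_and_jump hQ hd0 htri hp t ht w hwN
    obtain ⟨hp0, hp1, hpk⟩ := hp w hw1 hwN
    obtain ⟨C, hC⟩ := exists_costToGo_le Q d p w t
    have hdw := add_nonneg (hd0 w 0 hwN h0) (hd0 0 w h0 hwN)
    have hE : costToGo Q d p 0 t Q - d 0 w ≤ serveCost Q d p w (costToGo Q d p w t) Q := by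
      have hc := hp1.mul_left (costToGo Q d p 0 t Q - d 0 w)
      rw [mul_one] at hc
      rw [← hc.tsum_eq]
      refine Summable.tsum_le_tsum (fun k => mul_le_mul_of_nonneg_right ?_ (hp0 k)) hc.summable
        (serveCost_summable hQ hdw hp0 hp1.summable hpk
          (costToGo_nonneg hd0 (fun m h1 h2 => (hp m h1 h2).1) t ht w hwN) hC Q)
      have h1 := hstart _ (loadAfter_le hQ k le_rfl)
      have h2 : (0 : ℝ) ≤ psi Q k Q := by exact_mod_cast psi_nonneg Q k Q
      linarith [mul_nonneg hdw h2]
    have h00 := hd0 0 0 h0 h0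
    exact le_min (by linarith) (by linarith)

theorem chainVal_neg_append (α : ℕ → ℝ) (e σ : List ℕ) (b : ℕ) :
    ∀ a a', chainVal (fun _ j => -α j) a (e ++ σ) b =
      chainVal (fun _ j => -α j) a' σ b - (e.map α).sum := by
  induction e with
  | nil => intro a a'; cases σ <;> simp [chainVal]
  | cons w e ih =>
    intro a a'
    simp only [List.cons_append, chainVal, ih w a', List.map_cons, List.sum_cons]
    ring

theorem sum_map_eq_sum_count {N : ℕ} (f : ℕ → ℝ) (e : List ℕ) (he : ∀ u ∈ e, 1 ≤ u ∧ u ≤ N) :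
    (e.map f).sum = ∑ i ∈ Finset.Icc 1 N, (e.count i : ℝ) * f i := by
  rw [Finset.sum_list_map_count]
  simp only [nsmul_eq_mul]
  refine Finset.sum_subset (fun u hu => ?_) (fun u _ hu => ?_)
  · exact Finset.mem_Icc.2 (he u (List.mem_toFinset.1 hu))
  · rw [List.count_eq_zero_of_not_mem (fun h => hu (List.mem_toFinset.2 h))]
    simp

theorem bddAbove_knapsack {N : ℕ} {μ α : ℕ → ℝ} (hμ : ∀ i, 1 ≤ i → i ≤ N → 0 < μ i) (C : ℝ) :
    BddAbove {x : ℝ | ∃ m : ℕ → ℕ,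
      (∑ i ∈ Finset.Icc 1 N, (m i : ℝ) * μ i) ≤ C ∧
      x = ∑ i ∈ Finset.Icc 1 N, (m i : ℝ) * α i} := by
  refine ⟨∑ i ∈ Finset.Icc 1 N, C / μ i * |α i|, ?_⟩
  rintro x ⟨m, hm, rfl⟩
  refine Finset.sum_le_sum fun i hi => ?_
  have hpos : ∀ j ∈ Finset.Icc 1 N, 0 < μ j := fun j hj =>
    hμ j (Finset.mem_Icc.1 hj).1 (Finset.mem_Icc.1 hj).2
  have h1 : (m i : ℝ) * μ i ≤ C := (Finset.single_le_sum
    (f := fun j => (m j : ℝ) * μ j)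
    (fun j hj => mul_nonneg (Nat.cast_nonneg _) (hpos j hj).le) hi).trans hm
  have h2 : (m i : ℝ) ≤ C / μ i := (le_div_iff₀ (hpos i hi)).2 h1
  exact (mul_le_mul_of_nonneg_left (le_abs_self _) (Nat.cast_nonneg _)).trans
    (mul_le_mul_of_nonneg_right h2 (abs_nonneg _))

theorem sum_map_le_kappa {N : ℕ} {μ α : ℕ → ℝ} (hμ : ∀ i, 1 ≤ i → i ≤ N → 0 < μ i) {C : ℝ}
    {e : List ℕ} (he : ∀ u ∈ e, 1 ≤ u ∧ u ≤ N) (hC : (e.map μ).sum ≤ C) :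
    (e.map α).sum ≤ kappa N μ α C :=
  le_csSup (bddAbove_knapsack hμ C)
    ⟨fun i => e.count i, by rwa [← sum_map_eq_sum_count μ e he], sum_map_eq_sum_count α e he⟩

/-- Proposition 4 of the paper: knapsack completion bound, for
set-partitioning duals `γ(i,j) = −α_j`, `α_0 = 0`, all expected demands
positive: for a partial route suffix `σ` and remaining load `rl ≥ 0`, every
feasible completion `e` (total expected demand at most `rl`) satisfies
`φ(r_e) ≥ φ(r_0) − κ(rl)`. -/
theorem stmt12 (Q N : ℕ) (hQ : 1 ≤ Q)
    (d : ℕ → ℕ → ℝ) (hd0 : ∀ i j, i ≤ N → j ≤ N → 0 ≤ d i j)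
    (htri : ∀ i j k, i ≤ N → j ≤ N → k ≤ N → d i j ≤ d i k + d k j)
    (p : ℕ → ℕ → ℝ)
    (hp : ∀ m, 1 ≤ m → m ≤ N →
      (∀ k, 0 ≤ p m k) ∧ HasSum (p m) 1 ∧ Summable fun k : ℕ => (k : ℝ) * p m k)
    (α : ℕ → ℝ) (hα0 : α 0 = 0)
    (hμpos : ∀ i, 1 ≤ i → i ≤ N → 0 < muE p i)
    (σ : List ℕ) (hσ : σ ≠ []) (hσC : ∀ u ∈ σ, 1 ≤ u ∧ u ≤ N)
    (rl : ℝ) (hrl : 0 ≤ rl) :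
    ∀ e : List ℕ, (∀ u ∈ e, 1 ≤ u ∧ u ≤ N) → (e.map (muE p)).sum ≤ rl →
      routePhi Q d p (fun _ j => -α j) σ - kappa N (muE p) α rl ≤
        routePhi Q d p (fun _ j => -α j) (e ++ σ) := by
  intro e he hload
  have hcost := costToGo_le_append hQ hd0 htri hp hσC e he
  have hdual := sum_map_le_kappa (α := α) hμpos he hload
  rw [routePhi, routePhi, routeCost_eq_costToGo, routeCost_eq_costToGo,
    chainVal_neg_append α e σ 0 0 0]
  linarith
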